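/- Let r ≥ 3 and m ≥ 2r² + 2r, and let ℱ_m = {B_{m,m}, V_{m,r}, Λ_{m,r}}. Then: (i) for every n divisible by m, sat(n, K_r, ℱ_m) ≤ (n/m)·C(m,r); and (ii) for every real ε > 0 there exists n₀ such that for all n ≥ n₀ with n not divisible by m, sat(n, K_r, ℱ_m) ≥ (n/m)·(C(m,r) + 1) - ε·n. -/

import Mathlib

open SimpleGraph Finset

variable {V : Type*}

/-- The graph `G` with the edge `u v` added. -/
def addEdge (G : SimpleGraph V) (u v : V) : SimpleGraph V :=
  G ⊔ SimpleGraph.fromEdgeSet {s(u, v)}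

/-- `G` is `K_s`-saturated: `G` is `K_s`-free and adding any missing edge creates a `K_s`. -/
def KSat (s : ℕ) (G : SimpleGraph V) : Prop :=
  G.CliqueFree s ∧ ∀ u v : V, u ≠ v → ¬ G.Adj u v → ¬ (addEdge G u v).CliqueFree s

/-- The number of copies of `K_r` in `G`: the number of `r`-sets of vertices inducing
a complete graph. -/
noncomputable def cliqueCount (G : SimpleGraph V) (r : ℕ) : ℕ :=
  {t : Finset V | G.IsNClique r t}.ncard

/-- `sat(n, K_r, K_s)`: minimum number of copies of `K_r` in an `n`-vertex
`K_s`-saturated graph. -/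
noncomputable def satCliques (n r s : ℕ) : ℕ :=
  sInf {m | ∃ G : SimpleGraph (Fin n), KSat s G ∧ cliqueCount G r = m}

/-- The join `K_{s-2} ∗ ∅_{n-s+2}` on `Fin n`. -/
def joinGraph (n s : ℕ) : SimpleGraph (Fin n) :=
  SimpleGraph.fromRel (fun i _ => (i : ℕ) < s - 2)

/-- The number of copies of `C_r` in `G` : the number of subgraphs of `G`
isomorphic to the cycle on `r` vertices. -/
noncomputable def cycleCount (G : SimpleGraph V) (r : ℕ) : ℕ :=
  {H : G.Subgraph | Nonempty (H.coe ≃g cycleGraph r)}.ncard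

/-- `sat(n, C_r, K_s)`. -/
noncomputable def satCyclesCliqueSat (n r s : ℕ) : ℕ :=
  sInf {m | ∃ G : SimpleGraph (Fin n), KSat s G ∧ cycleCount G r = m}

/-- `G` contains a copy of `F`, i.e. a subgraph isomorphic to `F`. -/
def ContainsCopy {α β : Type*} (F : SimpleGraph α) (G : SimpleGraph β) : Prop :=
  ∃ f : α → β, Function.Injective f ∧ ∀ a b : α, F.Adj a b → G.Adj (f a) (f b)

/-- strongly K_s-saturated -/
def StronglyKSat (s : ℕ) (G : SimpleGraph V) : Prop :=
  ∀ u v : V, u ≠ v → ¬ G.Adj u v →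
    ∃ t : Finset V, (addEdge G u v).IsNClique s t ∧ u ∈ t ∧ v ∈ t

/-- dumbbell -/
def dumbbell (m : ℕ) : SimpleGraph (Fin (2 * m)) :=
  SimpleGraph.fromRel (fun i j =>
    ((i : ℕ) < m ∧ (j : ℕ) < m) ∨ (m ≤ (i : ℕ) ∧ m ≤ (j : ℕ)) ∨ ((i : ℕ) = 0 ∧ (j : ℕ) = m))

def Vgraph (m : ℕ) : SimpleGraph (Fin (m + 2)) :=
  SimpleGraph.fromRel (fun i j =>
    ((i : ℕ) < m ∧ (j : ℕ) < m) ∨ ((i : ℕ) = 0 ∧ m ≤ (j : ℕ)))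

def lambdaGraph (m : ℕ) : SimpleGraph (Fin (m + 1)) :=
  SimpleGraph.fromRel (fun i j =>
    ((i : ℕ) < m ∧ (j : ℕ) < m) ∨ ((i : ℕ) = m ∧ (j : ℕ) < 2))

def VgraphGen (m r : ℕ) : SimpleGraph (Fin (m + (m - r))) :=
  SimpleGraph.fromRel (fun i j =>
    ((i : ℕ) < m ∧ (j : ℕ) < m) ∨
      (((i : ℕ) = 0 ∨ m ≤ (i : ℕ)) ∧ ((j : ℕ) = 0 ∨ m ≤ (j : ℕ))))

def lambdaGraphGen (m r : ℕ) : SimpleGraph (Fin (m + 1)) :=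
  SimpleGraph.fromRel (fun i j =>
    ((i : ℕ) < m ∧ (j : ℕ) < m) ∨ ((i : ℕ) = m ∧ (j : ℕ) < r))

/-- `G` is saturated with respect to the family `{F₁, F₂, F₃}`. -/
def FamSat3 {α₁ α₂ α₃ : Type*} (F₁ : SimpleGraph α₁) (F₂ : SimpleGraph α₂)
    (F₃ : SimpleGraph α₃) (G : SimpleGraph V) : Prop :=
  ¬ ContainsCopy F₁ G ∧ ¬ ContainsCopy F₂ G ∧ ¬ ContainsCopy F₃ G ∧
    ∀ u v : V, u ≠ v → ¬ G.Adj u v →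
      ContainsCopy F₁ (addEdge G u v) ∨ ContainsCopy F₂ (addEdge G u v) ∨
        ContainsCopy F₃ (addEdge G u v)

noncomputable def satFam3 {α₁ α₂ α₃ : Type*} (n : ℕ) (F₁ : SimpleGraph α₁)
    (F₂ : SimpleGraph α₂) (F₃ : SimpleGraph α₃) : ℕ :=
  sInf {m | ∃ G : SimpleGraph (Fin n), FamSat3 F₁ F₂ F₃ G ∧ G.edgeSet.ncard = m}

noncomputable def satCliquesFam3 {α₁ α₂ α₃ : Type*} (n r : ℕ) (F₁ : SimpleGraph α₁)
    (F₂ : SimpleGraph α₂) (F₃ : SimpleGraph α₃) : ℕ :=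
  sInf {m | ∃ G : SimpleGraph (Fin n), FamSat3 F₁ F₂ F₃ G ∧ cliqueCount G r = m}

/-- saturation w.r.t. a single graph, with copies as subgraphs. -/
def SatGraph {α : Type*} (F : SimpleGraph α) (G : SimpleGraph V) : Prop :=
  ¬ ContainsCopy F G ∧ ∀ u v : V, u ≠ v → ¬ G.Adj u v → ContainsCopy F (addEdge G u v)

noncomputable def satCyclesGraphSat {α : Type*} (n r : ℕ) (F : SimpleGraph α) : ℕ :=
  sInf {m | ∃ G : SimpleGraph (Fin n), SatGraph F G ∧ cycleCount G r = m}

/-- number of independent sets of size l -/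
noncomputable def indepCount (G : SimpleGraph V) (l : ℕ) : ℕ :=
  {t : Finset V | t.card = l ∧ ∀ a ∈ t, ∀ b ∈ t, ¬ G.Adj a b}.ncard

/-- Ramsey number -/
noncomputable def ramsey (l s : ℕ) : ℕ :=
  sInf {N | ∀ G : SimpleGraph (Fin N),
    (∃ t : Finset (Fin N), t.card = l ∧ ∀ a ∈ t, ∀ b ∈ t, ¬ G.Adj a b) ∨
      ∃ t : Finset (Fin N), G.IsNClique s t}

section Copies

lemma addEdge_adj {G : SimpleGraph V} {u v a b : V} :
    (addEdge G u v).Adj a b ↔ G.Adj a b ∨ ((a = u ∧ b = v ∨ a = v ∧ b = u) ∧ a ≠ b) := by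
  simp [addEdge]

lemma le_addEdge (G : SimpleGraph V) (u v : V) : G ≤ addEdge G u v := le_sup_left

/-- A finite set can be listed so that a prescribed subset comes first. -/
lemma exists_listing_of_subset [DecidableEq V] {A S : Finset V} (hSA : S ⊆ A)
    (hA : A.Nonempty) :
    ∃ f : ℕ → V, (∀ i < #A, f i ∈ A) ∧ (∀ i < #A, ∀ j < #A, f i = f j → i = j) ∧
      ∀ i < #S, f i ∈ S := by
  obtain ⟨d, -⟩ := hA
  set l := S.toList ++ (A \ S).toList with hl
  have hlen : l.length = #A := by
    simp [hl, card_sdiff_of_subset hSA, card_le_card hSA]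
  have hnd : l.Nodup := by
    refine List.Nodup.append S.nodup_toList (A \ S).nodup_toList ?_
    intro x hx hx'
    simp at hx hx'
    exact hx'.2 hx
  have hmem : ∀ x ∈ l, x ∈ A := by
    intro x hx
    simp only [hl, List.mem_append, mem_toList, mem_sdiff] at hx
    rcases hx with h | h
    exacts [hSA h, h.1]
  refine ⟨fun i => l.getD i d, ?_, ?_, ?_⟩
  · intro i hi
    rw [← hlen] at hi
    simp only [List.getD_eq_getElem _ _ hi]
    exact hmem _ (List.getElem_mem _)
  · intro i hi j hj h
    rw [← hlen] at hi hj
    simp only [List.getD_eq_getElem _ _ hi, List.getD_eq_getElem _ _ hj] at h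
    exact (hnd.getElem_inj_iff).1 h
  · intro i hi
    have hi' : i < S.toList.length := by simpa using hi
    have hi'' : i < l.length := by simp [hl]; omega
    simp only [List.getD_eq_getElem _ _ hi'']
    simp only [hl, List.getElem_append_left hi']
    exact mem_toList.1 (List.getElem_mem _)

lemma containsCopy_dumbbell [DecidableEq V] {G : SimpleGraph V} {m : ℕ} {A B : Finset V}
    (hA : G.IsNClique m A) (hB : G.IsNClique m B) (hAB : Disjoint A B) {a b : V}
    (ha : a ∈ A) (hb : b ∈ B) (hab : G.Adj a b) : ContainsCopy (dumbbell m) G := by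
  obtain ⟨f, hfA, hfi, hfa⟩ := exists_listing_of_subset (singleton_subset_iff.2 ha) ⟨a, ha⟩
  obtain ⟨g, hgB, hgi, hgb⟩ := exists_listing_of_subset (singleton_subset_iff.2 hb) ⟨b, hb⟩
  rw [hA.card_eq] at hfA hfi
  rw [hB.card_eq] at hgB hgi
  simp only [card_singleton, mem_singleton] at hfa hgb
  have hdisj : ∀ i < m, ∀ j < m, f i ≠ g j := fun i hi j hj h =>
    disjoint_left.1 hAB (hfA i hi) (h ▸ hgB j hj)
  refine ⟨fun i => if (i : ℕ) < m then f i else g (i - m), ?_, ?_⟩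
  · rintro ⟨i, hi⟩ ⟨j, hj⟩ h
    simp only [Fin.mk.injEq] at h ⊢
    split_ifs at h with h₁ h₂ h₂
    · exact hfi _ h₁ _ h₂ h
    · exact absurd h (hdisj _ h₁ _ (by omega))
    · exact absurd h.symm (hdisj _ h₂ _ (by omega))
    · have := hgi _ (by omega) _ (by omega) h
      omega
  · have key : ∀ i j : ℕ, i < 2 * m → j < 2 * m → i ≠ j →
        ((i < m ∧ j < m) ∨ (m ≤ i ∧ m ≤ j) ∨ (i = 0 ∧ j = m)) →
        G.Adj (if i < m then f i else g (i - m)) (if j < m then f j else g (j - m)) := by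
      rintro i j hi hj hij (⟨h₁, h₂⟩ | ⟨h₁, h₂⟩ | ⟨rfl, rfl⟩)
      · rw [if_pos h₁, if_pos h₂]
        exact hA.isClique (hfA _ h₁) (hfA _ h₂) fun h => hij (hfi _ h₁ _ h₂ h)
      · rw [if_neg (by omega), if_neg (by omega)]
        refine hB.isClique (hgB _ (by omega)) (hgB _ (by omega)) fun h => ?_
        have := hgi _ (by omega) _ (by omega) h
        omega
      · rw [if_pos (by omega), if_neg (by omega), Nat.sub_self, hfa 0 (by omega), hgb 0 (by omega)]
        exact hab
    rintro ⟨i, hi⟩ ⟨j, hj⟩ h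
    simp only [dumbbell, fromRel_adj, ne_eq, Fin.mk.injEq] at h
    rcases h with ⟨hij, h | h⟩
    · exact key i j hi hj hij h
    · exact (key j i hj hi (Ne.symm hij) h).symm

lemma containsCopy_VgraphGen [DecidableEq V] {G : SimpleGraph V} {m r : ℕ} {A B : Finset V} {x : V}
    (hA : G.IsNClique m A) (hB : G.IsNClique (m - r + 1) B) (hAB : A ∩ B = {x}) :
    ContainsCopy (VgraphGen m r) G := by
  have hx : x ∈ A ∩ B := by simp [hAB]
  rw [mem_inter] at hx
  obtain ⟨f, hfA, hfi, hfa⟩ := exists_listing_of_subset (singleton_subset_iff.2 hx.1) ⟨x, hx.1⟩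
  obtain ⟨g, hgB, hgi, hgb⟩ := exists_listing_of_subset (singleton_subset_iff.2 hx.2) ⟨x, hx.2⟩
  rw [hA.card_eq] at hfA hfi
  rw [hB.card_eq] at hgB hgi
  simp only [card_singleton, mem_singleton] at hfa hgb
  have hdisj : ∀ i < m, ∀ j < m - r + 1, 0 < j → f i ≠ g j := by
    intro i hi j hj hj0 h
    have : f i ∈ A ∩ B := mem_inter.2 ⟨hfA i hi, h ▸ hgB j hj⟩
    rw [hAB, mem_singleton, h, ← hgb 0 one_pos] at this
    have := hgi _ hj _ (by omega) this
    omega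
  refine ⟨fun i => if (i : ℕ) < m then f i else g (i - m + 1), ?_, ?_⟩
  · rintro ⟨i, hi⟩ ⟨j, hj⟩ h
    simp only [Fin.mk.injEq] at h ⊢
    split_ifs at h with h₁ h₂ h₂
    · exact hfi _ h₁ _ h₂ h
    · exact absurd h (hdisj _ h₁ _ (by omega) (by omega))
    · exact absurd h.symm (hdisj _ h₂ _ (by omega) (by omega))
    · have := hgi _ (by omega) _ (by omega) h
      omega
  · have hval : ∀ i : ℕ, i < m + (m - r) → (i = 0 ∨ m ≤ i) →
        (if i < m then f i else g (i - m + 1)) = g (if i = 0 then 0 else i - m + 1) := by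
      rintro i hi (rfl | h)
      · have : 0 < m := by rw [← hA.card_eq]; exact card_pos.2 ⟨x, hx.1⟩
        rw [if_pos this, if_pos rfl, hfa 0 one_pos, hgb 0 one_pos]
      · have : 0 < m := by rw [← hA.card_eq]; exact card_pos.2 ⟨x, hx.1⟩
        rw [if_neg (by omega), if_neg (by omega)]
    have key : ∀ i j : ℕ, i < m + (m - r) → j < m + (m - r) → i ≠ j →
        ((i < m ∧ j < m) ∨ ((i = 0 ∨ m ≤ i) ∧ (j = 0 ∨ m ≤ j))) →
        G.Adj (if i < m then f i else g (i - m + 1)) (if j < m then f j else g (j - m + 1)) := by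
      rintro i j hi hj hij (⟨h₁, h₂⟩ | ⟨h₁, h₂⟩)
      · rw [if_pos h₁, if_pos h₂]
        exact hA.isClique (hfA _ h₁) (hfA _ h₂) fun h => hij (hfi _ h₁ _ h₂ h)
      · rw [hval i hi h₁, hval j hj h₂]
        have b₁ : (if i = 0 then 0 else i - m + 1) < m - r + 1 := by split_ifs <;> omega
        have b₂ : (if j = 0 then 0 else j - m + 1) < m - r + 1 := by split_ifs <;> omega
        refine hB.isClique (hgB _ b₁) (hgB _ b₂) fun h => ?_
        have := hgi _ b₁ _ b₂ h
        split_ifs at this <;> omega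
    rintro ⟨i, hi⟩ ⟨j, hj⟩ h
    simp only [VgraphGen, fromRel_adj, ne_eq, Fin.mk.injEq] at h
    rcases h with ⟨hij, h | h⟩
    · exact key i j hi hj hij h
    · exact (key j i hj hi (Ne.symm hij) h).symm

lemma containsCopy_lambdaGraphGen [DecidableEq V] {G : SimpleGraph V} {m r : ℕ}
    {A S : Finset V} {p : V} (hA : G.IsNClique m A) (hp : p ∉ A) (hSA : S ⊆ A) (hS : #S = r)
    (hadj : ∀ s ∈ S, G.Adj p s) : ContainsCopy (lambdaGraphGen m r) G := by
  rcases A.eq_empty_or_nonempty with rfl | hne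
  · obtain rfl : m = 0 := by simpa using hA.card_eq.symm
    refine ⟨fun _ => p, fun i j _ => Subsingleton.elim (α := Fin 1) i j, fun a b h => ?_⟩
    exact absurd (Subsingleton.elim (α := Fin 1) a b) h.ne
  obtain ⟨f, hfA, hfi, hfS⟩ := exists_listing_of_subset hSA hne
  rw [hA.card_eq] at hfA hfi
  rw [hS] at hfS
  have hrm : r ≤ m := by rw [← hS, ← hA.card_eq]; exact card_le_card hSA
  refine ⟨fun i => if (i : ℕ) < m then f i else p, ?_, ?_⟩
  · rintro ⟨i, hi⟩ ⟨j, hj⟩ h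
    simp only [Fin.mk.injEq] at h ⊢
    split_ifs at h with h₁ h₂ h₂
    · exact hfi _ h₁ _ h₂ h
    · exact absurd (h ▸ hfA _ h₁) hp
    · exact absurd (h ▸ hfA _ h₂) hp
    · omega
  · have key : ∀ i j : ℕ, i < m + 1 → j < m + 1 → i ≠ j →
        ((i < m ∧ j < m) ∨ (i = m ∧ j < r)) →
        G.Adj (if i < m then f i else p) (if j < m then f j else p) := by
      rintro i j hi hj hij (⟨h₁, h₂⟩ | ⟨h₁, h₂⟩)
      · rw [if_pos h₁, if_pos h₂]
        exact hA.isClique (hfA _ h₁) (hfA _ h₂) fun h => hij (hfi _ h₁ _ h₂ h)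
      · rw [if_neg (by omega), if_pos (by omega)]
        exact hadj _ (hfS _ h₂)
    rintro ⟨i, hi⟩ ⟨j, hj⟩ h
    simp only [lambdaGraphGen, fromRel_adj, ne_eq, Fin.mk.injEq] at h
    rcases h with ⟨hij, h | h⟩
    · exact key i j hi hj hij h
    · exact (key j i hj hi (Ne.symm hij) h).symm

/-- The image of a pairwise adjacent set of indices under a copy is a clique. -/
lemma isNClique_image_filter [DecidableEq V] {G : SimpleGraph V} {N c : ℕ}
    {F : SimpleGraph (Fin N)} {f : Fin N → V} (hf : Function.Injective f)
    (hadj : ∀ a b, F.Adj a b → G.Adj (f a) (f b)) {s : Finset (Fin N)} (hs : F.IsNClique c s) :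
    G.IsNClique c (s.image f) := by
  refine ⟨?_, by rw [card_image_of_injective _ hf, hs.card_eq]⟩
  intro x hx y hy hxy
  simp only [coe_image, Set.mem_image, mem_coe] at hx hy
  obtain ⟨i, hi, rfl⟩ := hx
  obtain ⟨j, hj, rfl⟩ := hy
  exact hadj _ _ (hs.isClique hi hj fun h => hxy (h ▸ rfl))

lemma card_filter_fin_lt {N c : ℕ} (hc : c ≤ N) : #{i : Fin N | (i : ℕ) < c} = c := by
  rw [Fin.card_filter_val_lt, min_eq_right hc]

lemma exists_of_containsCopy_dumbbell [DecidableEq V] {G : SimpleGraph V} {m : ℕ} (hm : 0 < m)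
    (h : ContainsCopy (dumbbell m) G) :
    ∃ A B : Finset V, G.IsNClique m A ∧ G.IsNClique m B ∧ Disjoint A B ∧
      ∃ a ∈ A, ∃ b ∈ B, G.Adj a b := by
  obtain ⟨f, hf, hadj⟩ := h
  have hlt : #{i : Fin (2 * m) | (i : ℕ) < m} = m := card_filter_fin_lt (by omega)
  have hge : #{i : Fin (2 * m) | ¬ (i : ℕ) < m} = m := by
    have := card_filter_add_card_filter_not (s := (univ : Finset (Fin (2 * m))))
      (fun i => (i : ℕ) < m)
    rw [hlt, card_univ, Fintype.card_fin] at this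
    omega
  refine ⟨({i : Fin (2 * m) | (i : ℕ) < m} : Finset _).image f,
    ({i : Fin (2 * m) | ¬ (i : ℕ) < m} : Finset _).image f,
    isNClique_image_filter hf hadj ⟨?_, hlt⟩, isNClique_image_filter hf hadj ⟨?_, hge⟩, ?_,
    f ⟨0, by omega⟩, ?_, f ⟨m, by omega⟩, ?_, hadj _ _ ?_⟩
  · intro i hi j hj hij
    simp only [coe_filter, mem_univ, true_and, Set.mem_ofPred_eq] at hi hj
    simp [dumbbell, hij, hi, hj]
  · intro i hi j hj hij
    simp only [coe_filter, mem_univ, true_and, Set.mem_ofPred_eq, not_lt] at hi hj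
    simp [dumbbell, hij, hi, hj]
  · rw [disjoint_image hf]
    exact disjoint_filter_filter_not _ _ _
  · exact mem_image_of_mem _ (by simpa using hm)
  · exact mem_image_of_mem _ (by simp)
  · simp [dumbbell]; omega

lemma exists_of_containsCopy_VgraphGen [DecidableEq V] {G : SimpleGraph V} {m r : ℕ} (hm : 0 < m)
    (h : ContainsCopy (VgraphGen m r) G) :
    ∃ (A B : Finset V) (x : V), G.IsNClique m A ∧ G.IsNClique (m - r + 1) B ∧ A ∩ B = {x} := by
  obtain ⟨f, hf, hadj⟩ := h
  have hlt : #{i : Fin (m + (m - r)) | (i : ℕ) < m} = m := card_filter_fin_lt (by omega)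
  have hge : #{i : Fin (m + (m - r)) | ¬ (i : ℕ) < m} = m - r := by
    have := card_filter_add_card_filter_not (s := (univ : Finset (Fin (m + (m - r)))))
      (fun i => (i : ℕ) < m)
    rw [hlt, card_univ, Fintype.card_fin] at this
    omega
  have hge' : #(insert ⟨0, by omega⟩ ({i : Fin (m + (m - r)) | ¬ (i : ℕ) < m} : Finset _) : Finset _)
      = m - r + 1 := by
    rw [card_insert_of_notMem (by simpa using hm.ne'), hge]
  refine ⟨({i : Fin (m + (m - r)) | (i : ℕ) < m} : Finset _).image f,
    (insert ⟨0, by omega⟩ ({i : Fin (m + (m - r)) | ¬ (i : ℕ) < m} : Finset _) : Finset _).image f,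
    f ⟨0, by omega⟩,
    isNClique_image_filter hf hadj ⟨?_, hlt⟩, isNClique_image_filter hf hadj ⟨?_, hge'⟩, ?_⟩
  · intro i hi j hj hij
    simp only [coe_filter, mem_univ, true_and, Set.mem_ofPred_eq] at hi hj
    simp [VgraphGen, hij, hi, hj]
  · intro i hi j hj hij
    simp only [coe_insert, coe_filter, mem_univ, true_and, Set.mem_ofPred_eq, not_lt,
      Set.mem_insert_iff, Fin.ext_iff] at hi hj
    simp [VgraphGen, hij, hi, hj]
  · rw [← image_inter _ _ hf, ← image_singleton]
    congr 1
    ext ⟨i, hi⟩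
    simp only [mem_inter, mem_filter, mem_univ, true_and, mem_insert, mem_singleton, Fin.mk.injEq]
    omega

lemma exists_of_containsCopy_lambdaGraphGen [DecidableEq V] {G : SimpleGraph V} {m r : ℕ}
    (hrm : r ≤ m) (h : ContainsCopy (lambdaGraphGen m r) G) :
    ∃ (A S : Finset V) (p : V), G.IsNClique m A ∧ p ∉ A ∧ S ⊆ A ∧ #S = r ∧
      ∀ s ∈ S, G.Adj p s := by
  obtain ⟨f, hf, hadj⟩ := h
  have hlt : #{i : Fin (m + 1) | (i : ℕ) < m} = m := card_filter_fin_lt (by omega)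
  have hlt' : #{i : Fin (m + 1) | (i : ℕ) < r} = r := card_filter_fin_lt (by omega)
  refine ⟨({i : Fin (m + 1) | (i : ℕ) < m} : Finset _).image f,
    ({i : Fin (m + 1) | (i : ℕ) < r} : Finset _).image f, f ⟨m, by omega⟩,
    isNClique_image_filter hf hadj ⟨?_, hlt⟩, ?_, ?_, ?_, ?_⟩
  · intro i hi j hj hij
    simp only [coe_filter, mem_univ, true_and, Set.mem_ofPred_eq] at hi hj
    simp [lambdaGraphGen, hij, hi, hj]
  · rw [hf.mem_finset_image]
    simp
  · refine image_subset_image fun i hi => ?_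
    simp only [mem_filter, mem_univ, true_and] at hi ⊢
    omega
  · rw [card_image_of_injective _ hf, hlt']
  · intro s hs
    obtain ⟨i, hi, rfl⟩ := mem_image.1 hs
    simp only [mem_filter, mem_univ, true_and] at hi
    refine hadj _ _ ?_
    rw [lambdaGraphGen, fromRel_adj, ne_eq, Fin.ext_iff]
    exact ⟨by simp only; omega, Or.inl (Or.inr ⟨rfl, hi⟩)⟩

end Copies

/-- `G` is saturated for the family `{B_{m,m}, V_{m,r}, Λ_{m,r}}`. -/
abbrev FamSaturated (m r : ℕ) (G : SimpleGraph V) : Prop :=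
  FamSat3 (dumbbell m) (VgraphGen m r) (lambdaGraphGen m r) G

section Structure

variable {G : SimpleGraph V} {u v : V}

lemma isClique_of_isClique_addEdge {K : Set V} (hK : (addEdge G u v).IsClique K)
    (huv : ¬(u ∈ K ∧ v ∈ K)) : G.IsClique K := by
  intro x hx y hy hxy
  rcases addEdge_adj.1 (hK hx hy hxy) with h | ⟨⟨rfl, rfl⟩ | ⟨rfl, rfl⟩, -⟩
  exacts [h, absurd ⟨hx, hy⟩ huv, absurd ⟨hy, hx⟩ huv]

lemma adj_of_addEdge_adj {a b : V} (h : (addEdge G u v).Adj a b) (h₁ : ¬(a = u ∧ b = v))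
    (h₂ : ¬(a = v ∧ b = u)) : G.Adj a b := by
  rw [addEdge_adj] at h
  tauto

lemma card_sdiff_pair [DecidableEq V] {K : Finset V} {c : ℕ} (hK : #K = c + 2) (hu : u ∈ K)
    (hv : v ∈ K) (huv : u ≠ v) : #(K \ {u, v}) = c := by
  rw [card_sdiff_of_subset (by simp [insert_subset_iff, hu, hv]), card_pair huv, hK]
  omega

/-- A clique through the added edge leaves a clique in the common neighbourhood of its ends. -/
lemma common_clique_of_addEdge [DecidableEq V] {K : Finset V} {c : ℕ}
    (hK : (addEdge G u v).IsNClique (c + 2) K) (hu : u ∈ K) (hv : v ∈ K) (huv : u ≠ v) :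
    G.IsNClique c (K \ {u, v}) ∧ ∀ q ∈ K \ {u, v}, G.Adj u q ∧ G.Adj v q := by
  refine ⟨⟨?_, card_sdiff_pair hK.card_eq hu hv huv⟩, fun q hq => ?_⟩
  · refine isClique_of_isClique_addEdge (u := u) (v := v) (hK.isClique.subset ?_) (by simp)
    exact coe_subset.2 sdiff_subset
  · simp only [mem_sdiff, mem_insert, mem_singleton, not_or] at hq
    obtain ⟨hq, hqu, hqv⟩ := hq
    exact ⟨adj_of_addEdge_adj (hK.isClique hu hq (Ne.symm hqu)) (by tauto) (by tauto),
      adj_of_addEdge_adj (hK.isClique hv hq (Ne.symm hqv)) (by tauto) (by tauto)⟩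

lemma isNClique_insert_of_subset [DecidableEq V] {m r : ℕ} {u : V} {A S : Finset V}
    (hA : G.IsNClique m A) (hr : 1 ≤ r) (hS : S ⊆ A) (hSc : #S = r - 1) (hadj : ∀ s ∈ S, G.Adj u s) :
    G.IsNClique r (insert u S) := by
  have := (⟨hA.isClique.subset (coe_subset.2 hS), hSc⟩ : G.IsNClique (r - 1) S).insert hadj
  rwa [Nat.sub_add_cancel hr] at this

namespace FamSaturated

variable [DecidableEq V] {m r : ℕ} {A B : Finset V}

lemma not_adj_of_disjoint (h : FamSaturated m r G) (hA : G.IsNClique m A) (hB : G.IsNClique m B)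
    (hAB : Disjoint A B) {a b : V} (ha : a ∈ A) (hb : b ∈ B) : ¬ G.Adj a b := fun hab =>
  h.1 (containsCopy_dumbbell hA hB hAB ha hb hab)

lemma inter_ne_singleton (h : FamSaturated m r G) (hA : G.IsNClique m A) (hB : G.IsClique B)
    (hc : m - r + 1 ≤ #B) (x : V) : A ∩ B ≠ {x} := by
  intro hAB
  have hx : x ∈ A ∩ B := by simp [hAB]
  obtain ⟨C, hxC, hCB, hC⟩ := exists_subsuperset_card_eq
    (singleton_subset_iff.2 (mem_inter.1 hx).2) (by simp) hc
  refine h.2.1 (containsCopy_VgraphGen (x := x) hA ⟨hB.subset (coe_subset.2 hCB), hC⟩ ?_)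
  refine subset_antisymm (hAB ▸ inter_subset_inter_left hCB) ?_
  exact singleton_subset_iff.2 (mem_inter.2 ⟨(mem_inter.1 hx).1, singleton_subset_iff.1 hxC⟩)

lemma card_lt_of_adj (h : FamSaturated m r G) (hA : G.IsNClique m A) {p : V} (hp : p ∉ A)
    {S : Finset V} (hSA : S ⊆ A) (hadj : ∀ s ∈ S, G.Adj p s) : #S < r := by
  by_contra! hS
  obtain ⟨T, hTS, hT⟩ := exists_subset_card_eq hS
  exact h.2.2.1 (containsCopy_lambdaGraphGen hA hp (hTS.trans hSA) hT fun s hs => hadj s (hTS hs))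

lemma disjoint_of_ne (h : FamSaturated m r G) (hA : G.IsNClique m A) (hB : G.IsNClique m B)
    (hAB : A ≠ B) : Disjoint A B := by
  by_contra hd
  obtain ⟨x, hxA, hxB⟩ := not_disjoint_iff.1 hd
  obtain ⟨b, hbB, hbA⟩ : ∃ b ∈ B, b ∉ A := by
    by_contra! hBA
    exact hAB (eq_of_subset_of_card_le hBA (by rw [hA.card_eq, hB.card_eq])).symm
  have hlt : #(B ∩ A) < r := h.card_lt_of_adj hA hbA inter_subset_right fun s hs =>
    hB.isClique hbB (mem_inter.1 hs).1 fun hbs => hbA (hbs ▸ (mem_inter.1 hs).2)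
  have hsub : insert x (B \ A) ⊆ B := insert_subset hxB sdiff_subset
  refine h.inter_ne_singleton hA (hB.isClique.subset (coe_subset.2 hsub)) ?_ x ?_
  · rw [card_insert_of_notMem (by simp [hxA])]
    have := card_sdiff_add_card_inter B A
    rw [hB.card_eq] at this
    omega
  · ext y
    simp only [mem_inter, mem_insert, mem_sdiff, mem_singleton]
    constructor
    · tauto
    · rintro rfl
      exact ⟨hxA, Or.inl rfl⟩

lemma not_adj_of_ne (h : FamSaturated m r G) (hA : G.IsNClique m A) (hB : G.IsNClique m B)
    (hAB : A ≠ B) {a b : V} (ha : a ∈ A) (hb : b ∈ B) : ¬ G.Adj a b :=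
  h.not_adj_of_disjoint hA hB (h.disjoint_of_ne hA hB hAB) ha hb

/-- The four ways in which a new edge `uv` can create a member of the family. -/
lemma exists_of_not_adj (h : FamSaturated m r G) (hm : 0 < m) (hrm : r ≤ m) (huv : u ≠ v)
    (hadj : ¬ G.Adj u v) :
    (∃ K, (addEdge G u v).IsNClique m K ∧ u ∈ K ∧ v ∈ K) ∨
    (∃ A B, G.IsNClique m A ∧ G.IsNClique m B ∧ u ∈ A ∧ v ∈ B) ∨
    (∃ (A B : Finset V) (x : V), G.IsNClique m A ∧ (addEdge G u v).IsNClique (m - r + 1) B ∧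
      A ∩ B = {x} ∧ u ∈ B ∧ v ∈ B) ∨
    (∃ (A S : Finset V) (p q : V), G.IsNClique m A ∧ p ∉ A ∧ q ∈ A ∧ S ⊆ A ∧ #S + 1 = r ∧
      (∀ s ∈ S, G.Adj p s) ∧ (p = u ∧ q = v ∨ p = v ∧ q = u)) := by
  by_cases hK : ∃ K, (addEdge G u v).IsNClique m K ∧ u ∈ K ∧ v ∈ K
  · exact Or.inl hK
  have hcl : ∀ {K}, (addEdge G u v).IsNClique m K → G.IsNClique m K := fun {K} h' =>
    ⟨isClique_of_isClique_addEdge h'.isClique fun h'' => hK ⟨K, h', h''⟩, h'.card_eq⟩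
  refine Or.inr ?_
  rcases h.2.2.2 u v huv hadj with hc | hc | hc
  · left
    obtain ⟨A, B, hA, hB, hAB, a, ha, b, hb, hab⟩ := exists_of_containsCopy_dumbbell hm hc
    have hA' := hcl hA
    have hB' := hcl hB
    rcases addEdge_adj.1 hab with hab | ⟨⟨rfl, rfl⟩ | ⟨rfl, rfl⟩, -⟩
    · exact absurd hab (h.not_adj_of_disjoint hA' hB' hAB ha hb)
    · exact ⟨A, B, hA', hB', ha, hb⟩
    · exact ⟨B, A, hB', hA', hb, ha⟩
  · right; left
    obtain ⟨A, B, x, hA, hB, hAB⟩ := exists_of_containsCopy_VgraphGen hm hc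
    have hA' := hcl hA
    refine ⟨A, B, x, hA', hB, hAB, ?_⟩
    by_contra hn
    exact h.inter_ne_singleton hA' (isClique_of_isClique_addEdge hB.isClique hn) hB.card_eq.ge x hAB
  · right; right
    obtain ⟨A, S, p, hA, hp, hSA, hS, hpS⟩ := exists_of_containsCopy_lambdaGraphGen hrm hc
    have hA' := hcl hA
    obtain ⟨q, hq, hpq⟩ : ∃ q ∈ S, ¬ G.Adj p q := by
      by_contra! hall
      exact absurd hS (h.card_lt_of_adj hA' hp hSA hall).ne
    have hpq' : p = u ∧ q = v ∨ p = v ∧ q = u := by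
      have := addEdge_adj.1 (hpS q hq)
      tauto
    refine ⟨A, S.erase q, p, q, hA', hp, hSA hq, (erase_subset _ _).trans hSA, ?_, ?_, hpq'⟩
    · rw [card_erase_add_one hq, hS]
    · intro s hs
      obtain ⟨hsq, hsS⟩ := mem_erase.1 hs
      have hpA : ∀ y ∈ A, p ≠ y := fun y hy hpy => hp (hpy ▸ hy)
      have h₁ := hpA _ (hSA hq)
      have h₂ := hpA _ (hSA hsS)
      refine adj_of_addEdge_adj (hpS s hsS) ?_ ?_ <;> rintro ⟨rfl, rfl⟩ <;> tauto

/-- Two nonadjacent vertices that lie in no `K_m` have a large common clique. -/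
lemma exists_common_clique (h : FamSaturated m r G) (hr : 2 ≤ r) (hrm : r + 1 ≤ m) (huv : u ≠ v)
    (hadj : ¬ G.Adj u v) (hu : ∀ A, G.IsNClique m A → u ∉ A) (hv : ∀ A, G.IsNClique m A → v ∉ A) :
    ∃ Q, G.IsNClique (m - r - 1) Q ∧ ∀ q ∈ Q, G.Adj u q ∧ G.Adj v q := by
  rcases h.exists_of_not_adj (by omega) (by omega) huv hadj with
    ⟨K, hK, huK, hvK⟩ | ⟨A, B, hA, hB, huA, hvB⟩ | ⟨A, B, x, hA, hB, hAB, huB, hvB⟩ |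
    ⟨A, S, p, q, hA, hp, hq, hSA, hS, hpS, ⟨rfl, rfl⟩ | ⟨rfl, rfl⟩⟩
  · rw [show m = (m - 2) + 2 by omega] at hK
    obtain ⟨hQ, hQadj⟩ := common_clique_of_addEdge hK huK hvK huv
    obtain ⟨Q, hQK, hQc⟩ := exists_subset_card_eq
      (show m - r - 1 ≤ #(K \ {u, v}) by rw [hQ.card_eq]; omega)
    exact ⟨Q, ⟨hQ.isClique.subset (coe_subset.2 hQK), hQc⟩, fun q hq => hQadj q (hQK hq)⟩
  · exact absurd huA (hu A hA)
  · rw [show m - r + 1 = (m - r - 1) + 2 by omega] at hB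
    exact ⟨_, common_clique_of_addEdge hB huB hvB huv⟩
  · exact absurd hq (hv A hA)
  · exact absurd hq (hu A hA)

/-- No `K_m` arises through an edge between a `K_m` and a vertex lying in no `K_m`. -/
lemma not_isNClique_addEdge (h : FamSaturated m r G) (hrm : r + 2 ≤ m)
    (hA : G.IsNClique m A) (hvA : v ∈ A) (huA : u ∉ A) {K : Finset V}
    (hK : (addEdge G u v).IsNClique m K) (huK : u ∈ K) (hvK : v ∈ K) : False := by
  have huv : u ≠ v := fun e => huA (e ▸ hvA)
  have hK' : (addEdge G u v).IsNClique ((m - 2) + 2) K := by rwa [show m - 2 + 2 = m by omega]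
  obtain ⟨hQ, hQadj⟩ := common_clique_of_addEdge hK' huK hvK huv
  have hcard := card_sdiff_add_card_inter K A
  rw [hK.card_eq] at hcard
  have hlt : #((K ∩ A).erase v) < r := by
    refine h.card_lt_of_adj hA huA ((erase_subset _ _).trans inter_subset_right) fun s hs => ?_
    simp only [mem_erase, mem_inter] at hs
    refine (hQadj s ?_).1
    simp only [mem_sdiff, mem_insert, mem_singleton, not_or]
    exact ⟨hs.2.1, fun e => huA (e ▸ hs.2.2), hs.1⟩
  have hvKA : v ∈ K ∩ A := mem_inter.2 ⟨hvK, hvA⟩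
  have herase := card_erase_add_one hvKA
  have hlt' : #(K ∩ A) < r := by
    obtain ⟨w, hw, hwu⟩ : ∃ w ∈ K \ A, w ≠ u := by
      refine exists_mem_ne ?_ u
      omega
    obtain ⟨hwK, hwA⟩ := mem_sdiff.1 hw
    refine h.card_lt_of_adj hA hwA inter_subset_right fun s hs => ?_
    obtain ⟨hsK, hsA⟩ := mem_inter.1 hs
    have hws : w ≠ s := fun e => hwA (e ▸ hsA)
    refine adj_of_addEdge_adj (hK.isClique hwK hsK hws) (by tauto) ?_
    rintro ⟨rfl, rfl⟩
    exact hwA hvA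
  have huKA : u ∈ K \ A := mem_sdiff.2 ⟨huK, huA⟩
  have hv' : v ∉ (K \ A).erase u := by simp [hvA]
  refine h.inter_ne_singleton (B := insert v ((K \ A).erase u)) hA ?_ ?_ v ?_
  · refine isClique_of_isClique_addEdge (u := u) (v := v) (hK.isClique.subset ?_) ?_
    · exact coe_subset.2 (insert_subset hvK ((erase_subset _ _).trans sdiff_subset))
    · simp [huv]
  · rw [card_insert_of_notMem hv', card_erase_of_mem huKA]
    omega
  · ext y
    simp only [mem_inter, mem_insert, mem_erase, mem_sdiff, mem_singleton]
    constructor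
    · tauto
    · rintro rfl
      exact ⟨hvA, Or.inl rfl⟩

/-- A vertex in no `K_m` and a nonadjacent vertex of a `K_m`. -/
lemma exists_subset_or_exists_clique (h : FamSaturated m r G) (hr : 2 ≤ r) (hrm : r + 2 ≤ m)
    (hA : G.IsNClique m A) (hvA : v ∈ A) (hu : ∀ A, G.IsNClique m A → u ∉ A)
    (hadj : ¬ G.Adj u v) :
    (∃ S ⊆ A, #S = r - 1 ∧ ∀ s ∈ S, G.Adj u s) ∨
    ∃ Q, G.IsNClique (m - r - 1) Q ∧ (∀ q ∈ Q, G.Adj u q ∧ G.Adj v q) ∧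
      ∀ q ∈ Q, ∀ B, G.IsNClique m B → q ∉ B := by
  have huA := hu A hA
  have huv : u ≠ v := fun e => huA (e ▸ hvA)
  rcases h.exists_of_not_adj (by omega) (by omega) huv hadj with
    ⟨K, hK, huK, hvK⟩ | ⟨A', B, hA', hB, huA', hvB⟩ | ⟨A', B, x, hA', hB, hAB, huB, hvB⟩ |
    ⟨A', S, p, q, hA', hp, hq, hSA, hS, hpS, ⟨rfl, rfl⟩ | ⟨rfl, rfl⟩⟩
  · exact (h.not_isNClique_addEdge hrm hA hvA huA hK huK hvK).elim
  · exact absurd huA' (hu A' hA')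
  · right
    have hx : x ∈ A' ∩ B := by simp [hAB]
    rw [mem_inter] at hx
    have hxu : x ≠ u := fun e => hu A' hA' (e ▸ hx.1)
    have hAA' : A = A' := by
      by_contra hne
      have hvA' : v ∉ A' := disjoint_left.1 (h.disjoint_of_ne hA hA' hne) hvA
      have hvx : v ≠ x := fun e => hvA' (e ▸ hx.1)
      refine h.not_adj_of_ne hA hA' hne hvA hx.1 ?_
      exact adj_of_addEdge_adj (hB.isClique hvB hx.2 hvx) (by tauto) (by tauto)
    subst hAA'
    rw [show m - r + 1 = (m - r - 1) + 2 by omega] at hB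
    obtain ⟨hQ, hQadj⟩ := common_clique_of_addEdge hB huB hvB huv
    refine ⟨_, hQ, hQadj, fun q hq C hC hqC => ?_⟩
    by_cases hAC : A = C
    · subst hAC
      simp only [mem_sdiff, mem_insert, mem_singleton, not_or] at hq
      have h₁ : q ∈ A ∩ B := mem_inter.2 ⟨hqC, hq.1⟩
      have h₂ : v ∈ A ∩ B := mem_inter.2 ⟨hvA, hvB⟩
      rw [hAB, mem_singleton] at h₁ h₂
      exact hq.2.2 (h₁.trans h₂.symm)
    · exact h.not_adj_of_ne hA hC hAC hvA hqC (hQadj q hq).2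
  · left
    have hAA' : A = A' := by
      by_contra hne
      exact disjoint_left.1 (h.disjoint_of_ne hA hA' hne) hvA hq
    subst hAA'
    exact ⟨S, hSA, by omega, hpS⟩
  · exact absurd hq (hu A' hA')

end FamSaturated

end Structure

section Counting

lemma choose_le_choose_sub_add (n k j : ℕ) (hj : j ≤ n) :
    n.choose (k + 1) ≤ (n - j).choose (k + 1) + j * (n - 1).choose k := by
  induction j with
  | zero => simp
  | succ j ih =>
    have h₁ := ih (by omega)
    obtain ⟨d, hd⟩ : ∃ d, n - j = d + 1 := ⟨n - j - 1, by omega⟩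
    rw [hd, Nat.choose_succ_succ'] at h₁
    rw [show n - (j + 1) = d by omega, Nat.succ_mul]
    have h₂ : d.choose k ≤ (n - 1).choose k := Nat.choose_le_choose k (by omega)
    omega

lemma choose_le_two_mul_choose {r m : ℕ} (hr : 2 ≤ r) (hm : 2 * r ^ 2 + 2 * r ≤ m) :
    (m - 1).choose (r - 1) ≤ 2 * (m - r - 1).choose (r - 1) := by
  obtain ⟨k, rfl⟩ : ∃ k, r = k + 2 := ⟨r - 2, by omega⟩
  have hm₂ : 2 ≤ m := by nlinarith
  obtain ⟨n, rfl⟩ : ∃ n, m = n + 2 := ⟨m - 2, by omega⟩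
  have hle : k + 2 ≤ n + 1 := by nlinarith
  have h₁ := choose_le_choose_sub_add (n + 1) k (k + 2) hle
  have h₂ := Nat.add_one_mul_choose_eq n k
  simp only [Nat.add_sub_cancel] at h₁
  rw [show n + 2 - 1 = n + 1 by omega, show k + 2 - 1 = k + 1 by omega,
    show n + 2 - (k + 2) - 1 = n + 1 - (k + 2) by omega]
  set E := (n + 1).choose (k + 1)
  set F := n.choose k
  have h₃ : 2 * (k + 2) * F ≤ E := by
    have h₄ : (n + 1) * (2 * (k + 2) * F) ≤ (n + 1) * E := by
      calc (n + 1) * (2 * (k + 2) * F) = 2 * (k + 2) * ((n + 1) * F) := by ring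
        _ = (2 * (k + 2) * (k + 1)) * E := by rw [h₂]; ring
        _ ≤ (n + 1) * E := Nat.mul_le_mul_right _ (by nlinarith)
    exact Nat.le_of_mul_le_mul_left h₄ (by omega)
  nlinarith

variable [DecidableEq V]

lemma card_mul_le_of_forall_le_card_filter {𝒯 : Finset (Finset V)} {X : Finset V} {r d : ℕ}
    (h𝒯 : ∀ t ∈ 𝒯, #t = r) (hX : ∀ x ∈ X, d ≤ #{t ∈ 𝒯 | x ∈ t}) : #X * d ≤ #𝒯 * r := by
  refine card_mul_le_card_mul (fun x t => x ∈ t) hX fun t ht => ?_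
  rw [← h𝒯 t ht]
  exact card_le_card fun x hx => (mem_filter.1 hx).2

lemma card_image_insert {𝒮 : Finset (Finset V)} {p : V} (h : ∀ S ∈ 𝒮, p ∉ S) :
    #(𝒮.image (insert p)) = #𝒮 := by
  refine card_image_of_injOn fun S hS S' hS' e => ?_
  have e' : insert p S = insert p S' := e
  rw [← erase_insert (h S hS), e', erase_insert (h S' hS')]

variable [Fintype V] {G : SimpleGraph V} [DecidableRel G.Adj]

/-- In a set where nonadjacent pairs share an `s`-clique, vertices lying in few copies of `K_r`
force almost `C(s, r - 1)` copies of `K_r` each. -/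
lemma card_sub_mul_choose_le {r s T : ℕ} (hr : 1 ≤ r) (hs : r - 1 ≤ s) (L : Finset V)
    (hL : ∀ u ∈ L, ∀ v ∈ L, u ≠ v → ¬ G.Adj u v →
      ∃ Q, G.IsNClique s Q ∧ ∀ q ∈ Q, G.Adj u q ∧ G.Adj v q)
    (hT : ∀ u ∈ L, #{t ∈ G.cliqueFinset r | u ∈ t} ≤ T) :
    (#L - (T + r + r * (T * r))) * s.choose (r - 1) ≤ #(G.cliqueFinset r) := by
  rcases L.eq_empty_or_nonempty with rfl | ⟨u₀, hu₀⟩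
  · simp
  rcases hr.eq_or_lt with rfl | hr
  · simp only [Nat.sub_self, Nat.choose_zero_right, mul_one]
    refine (Nat.sub_le _ _).trans ?_
    rw [← card_map (⟨fun x => {x}, singleton_injective⟩ : V ↪ Finset V)]
    refine card_le_card fun t ht => ?_
    obtain ⟨x, -, rfl⟩ := mem_map.1 ht
    simp [mem_cliqueFinset_iff, isNClique_iff]
  obtain ⟨U, hU, hUmax⟩ := exists_max_image
    ({U ∈ L.powerset | G.IsClique U ∧ #U ≤ r - 1} : Finset (Finset V)) (fun U => #U)
    ⟨{u₀}, by simp [hu₀]; omega⟩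
  simp only [mem_filter, mem_powerset] at hU hUmax
  obtain ⟨hUL, hUc, hUr⟩ := hU
  have hUne : U.Nonempty := by
    rw [← card_pos]
    have := hUmax {u₀} (by simp [hu₀]; omega)
    simpa using this
  obtain ⟨u₁, hu₁⟩ := hUne
  set D := {p ∈ L | ∀ u ∈ U, G.Adj u p} with hD
  have hDU : ∀ p ∈ D, p ∉ U := fun p hp hpU => G.irrefl ((mem_filter.1 hp).2 p hpU)
  have hDT : #D ≤ T := by
    refine le_trans ?_ (hT u₁ (hUL hu₁))
    have hins : ∀ p ∈ D, G.IsClique (insert p U : Finset V) := by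
      intro p hp
      rw [coe_insert]
      exact hUc.insert fun u hu _ => ((mem_filter.1 hp).2 u hu).symm
    by_cases hUr' : #U = r - 1
    · refine card_le_card_of_injOn (fun p => insert p U) (fun p hp => ?_) ?_
      · simp only [coe_filter, mem_cliqueFinset_iff, Set.mem_ofPred_eq]
        refine ⟨⟨hins p hp, ?_⟩, mem_insert_of_mem hu₁⟩
        rw [card_insert_of_notMem (hDU p hp)]
        omega
      · intro p hp q hq e
        have : p ∈ insert q U := by
          rw [← show insert p U = insert q U from e]
          exact mem_insert_self _ _
        exact (mem_insert.1 this).resolve_right (hDU p hp)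
    · suffices D = ∅ by simp [this]
      refine eq_empty_of_forall_notMem fun p hp => ?_
      have := hUmax (insert p U) ⟨insert_subset (mem_filter.1 hp).1 hUL, hins p hp, by
        rw [card_insert_of_notMem (hDU p hp)]; omega⟩
      rw [card_insert_of_notMem (hDU p hp)] at this
      omega
  set Z := U.biUnion fun u => ({t ∈ G.cliqueFinset r | u ∈ t} : Finset (Finset V)).biUnion id
    with hZ
  have hZc : #Z ≤ r * (T * r) := by
    refine (card_biUnion_le_card_mul _ _ (T * r) fun u hu => ?_).trans
      (Nat.mul_le_mul_right _ (by omega))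
    refine (card_biUnion_le_card_mul _ _ r fun t ht => ?_).trans
      (Nat.mul_le_mul_right _ (hT u (hUL hu)))
    exact ((mem_cliqueFinset_iff.1 (mem_filter.1 ht).1).card_eq).le
  have hcount : #L - (T + r + r * (T * r)) ≤ #(L \ (D ∪ U ∪ Z)) := by
    have h₁ := le_card_sdiff (D ∪ U ∪ Z) L
    have h₂ := card_union_le (D ∪ U) Z
    have h₃ := card_union_le D U
    omega
  refine (Nat.mul_le_mul_right _ hcount).trans ?_
  rw [← mul_one #(G.cliqueFinset r)]
  refine card_mul_le_card_mul (fun p t => t \ Z = {p}) (fun p hp => ?_) fun t _ => ?_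
  · simp only [mem_sdiff, mem_union, not_or] at hp
    obtain ⟨hpL, ⟨hpD, hpU⟩, hpZ⟩ := hp
    obtain ⟨u, hu, hup⟩ : ∃ u ∈ U, ¬ G.Adj u p := by
      by_contra! hall
      exact hpD (mem_filter.2 ⟨hpL, hall⟩)
    obtain ⟨Q, hQ, hQadj⟩ := hL u (hUL hu) p hpL (fun e => hpU (e ▸ hu)) hup
    rw [← hQ.card_eq, ← card_powersetCard, ← card_image_insert (p := p) (𝒮 := powersetCard (r - 1) Q)]
    · refine card_le_card fun t ht => ?_
      obtain ⟨S, hS, rfl⟩ := mem_image.1 ht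
      obtain ⟨hSQ, hSc⟩ := mem_powersetCard.1 hS
      have hcl : ∀ x, (∀ q ∈ Q, G.Adj x q) → G.IsNClique r (insert x S) := by
        intro x hx
        have := (⟨hQ.isClique.subset (coe_subset.2 hSQ), hSc⟩ : G.IsNClique (r - 1) S).insert
          (a := x) fun q hq => hx q (hSQ hq)
        rwa [Nat.sub_add_cancel hr.le] at this
      rw [mem_bipartiteAbove]
      refine ⟨mem_cliqueFinset_iff.2 (hcl p fun q hq => (hQadj q hq).2), ?_⟩
      have hSZ : S ⊆ Z := by
        intro q hq
        simp only [hZ, mem_biUnion, mem_filter, id]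
        exact ⟨u, hu, insert u S, ⟨mem_cliqueFinset_iff.2 (hcl u fun q hq => (hQadj q hq).1),
          mem_insert_self _ _⟩, mem_insert_of_mem hq⟩
      rw [insert_sdiff_of_notMem _ hpZ, sdiff_eq_empty_iff_subset.2 hSZ, insert_empty_eq]
    · intro S hS hpS
      exact G.irrefl (hQadj p ((mem_powersetCard.1 hS).1 hpS)).2
  · rw [card_le_one]
    intro p hp q hq
    rw [mem_bipartiteBelow] at hp hq
    exact singleton_injective (hp.2.symm.trans hq.2)

end Counting

section SaturatedCounting

variable [Fintype V] [DecidableEq V] {G : SimpleGraph V} [DecidableRel G.Adj] {m r : ℕ}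

/-- The vertices of `G` lying in no copy of `K_m`. -/
def vertsOffCliques (G : SimpleGraph V) [DecidableRel G.Adj] (m : ℕ) : Finset V :=
  univ \ (G.cliqueFinset m).biUnion id

lemma mem_vertsOffCliques {u : V} :
    u ∈ vertsOffCliques G m ↔ ∀ A, G.IsNClique m A → u ∉ A := by
  simp [vertsOffCliques, mem_cliqueFinset_iff]

namespace FamSaturated

lemma card_vertsOffCliques (h : FamSaturated m r G) :
    #(G.cliqueFinset m) * m + #(vertsOffCliques G m) = Fintype.card V := by
  have hc : #((G.cliqueFinset m).biUnion id) = #(G.cliqueFinset m) * m := by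
    rw [card_biUnion]
    · exact sum_const_nat fun A hA => (mem_cliqueFinset_iff.1 hA).card_eq
    · intro A hA B hB hAB
      exact h.disjoint_of_ne (mem_cliqueFinset_iff.1 hA) (mem_cliqueFinset_iff.1 hB) hAB
  rw [← hc, vertsOffCliques, card_univ_sdiff]
  have := card_le_univ ((G.cliqueFinset m).biUnion id)
  omega

/-- A vertex in no `K_m` with few neighbours in some `K_m` lies in many copies of `K_r` that avoid
all copies of `K_m`. -/
lemma choose_lt_card_filter (h : FamSaturated m r G) (hr : 3 ≤ r) (hm : 2 * r ^ 2 + 2 * r ≤ m)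
    {u : V} (hu : u ∈ vertsOffCliques G m) {A : Finset V} (hA : G.IsNClique m A)
    (huA : #{x ∈ A | G.Adj u x} < r - 1) :
    (m - 1).choose (r - 1) + 1 ≤
      #{t ∈ G.cliqueFinset r | t ⊆ vertsOffCliques G m ∧ u ∈ t} := by
  have hmr : 8 * r ≤ m := by nlinarith
  set R := vertsOffCliques G m with hR
  set 𝒮 : Finset (Finset V) :=
    {S ∈ powersetCard (r - 1) R | G.IsClique (S : Set V) ∧ ∀ s ∈ S, G.Adj u s} with h𝒮
  have h𝒮t : #𝒮 ≤ #{t ∈ G.cliqueFinset r | t ⊆ R ∧ u ∈ t} := by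
    rw [← card_image_insert (p := u) (𝒮 := 𝒮)]
    · refine card_le_card fun t ht => ?_
      obtain ⟨S, hS, rfl⟩ := mem_image.1 ht
      simp only [h𝒮, mem_filter, mem_powersetCard] at hS
      obtain ⟨⟨hSR, hSc⟩, hScl, hSu⟩ := hS
      have hcl := (⟨hScl, hSc⟩ : G.IsNClique (r - 1) S).insert hSu
      rw [Nat.sub_add_cancel (by omega)] at hcl
      exact mem_filter.2 ⟨mem_cliqueFinset_iff.2 hcl, insert_subset hu hSR, mem_insert_self _ _⟩
    · intro S hS huS
      exact G.irrefl ((mem_filter.1 hS).2.2 u huS)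
  refine le_trans ?_ h𝒮t
  have hdc : #{x ∈ A | ¬ G.Adj u x} * (m - r - 1).choose (r - 1) ≤ #𝒮 * (r - 1) := by
    refine card_mul_le_card_mul (fun v S => ∀ s ∈ S, G.Adj s v) (fun v hv => ?_) fun S hS => ?_
    · obtain ⟨hvA, huv⟩ := mem_filter.1 hv
      rcases h.exists_subset_or_exists_clique (by omega) (by omega) hA hvA
        (mem_vertsOffCliques.1 hu) huv with ⟨S, hSA, hSc, hSu⟩ | ⟨Q, hQ, hQadj, hQR⟩
      · refine absurd (card_le_card (s := S) (t := {x ∈ A | G.Adj u x}) ?_) (by omega)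
        exact fun s hs => mem_filter.2 ⟨hSA hs, hSu s hs⟩
      · rw [← hQ.card_eq, ← card_powersetCard]
        refine card_le_card fun S hS => ?_
        obtain ⟨hSQ, hSc⟩ := mem_powersetCard.1 hS
        rw [mem_bipartiteAbove, h𝒮, mem_filter, mem_powersetCard]
        exact ⟨⟨⟨fun q hq => mem_vertsOffCliques.2 (hQR q (hSQ hq)), hSc⟩,
          hQ.isClique.subset (coe_subset.2 hSQ), fun q hq => (hQadj q (hSQ hq)).1⟩,
          fun q hq => (hQadj q (hSQ hq)).2.symm⟩
    · simp only [h𝒮, mem_filter, mem_powersetCard] at hS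
      obtain ⟨⟨hSR, hSc⟩, -, -⟩ := hS
      obtain ⟨s, hs⟩ : S.Nonempty := card_pos.1 (by omega)
      refine Nat.le_sub_one_of_lt (h.card_lt_of_adj hA (mem_vertsOffCliques.1 (hSR hs) A hA)
        (fun v hv => ?_) fun v hv => ?_)
      · exact (mem_filter.1 ((mem_bipartiteBelow _).1 hv).1).1
      · exact ((mem_bipartiteBelow _).1 hv).2 s hs
  have hnon : m - r + 2 ≤ #{x ∈ A | ¬ G.Adj u x} := by
    have := card_filter_add_card_filter_not (s := A) (fun x => G.Adj u x)
    rw [hA.card_eq] at this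
    omega
  have hED := choose_le_two_mul_choose (by omega) hm
  have hE : 0 < (m - 1).choose (r - 1) := Nat.choose_pos (by omega)
  set E := (m - 1).choose (r - 1)
  set D := (m - r - 1).choose (r - 1)
  have h₁ : (4 * (r - 1)) * E ≤ 2 * (#𝒮 * (r - 1)) := calc
    (4 * (r - 1)) * E ≤ #{x ∈ A | ¬ G.Adj u x} * (2 * D) := Nat.mul_le_mul (by omega) hED
    _ ≤ 2 * (#𝒮 * (r - 1)) := by linarith
  have h₂ : 2 * E ≤ #𝒮 := by
    refine Nat.le_of_mul_le_mul_right (c := 2 * (r - 1)) ?_ (by omega)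
    linarith
  omega

/-- Vertices in no `K_m` having `r - 1` neighbours in every `K_m`. -/
def fullyAttached (G : SimpleGraph V) [DecidableRel G.Adj] (m r : ℕ) : Finset V :=
  {u ∈ vertsOffCliques G m | ∀ A ∈ G.cliqueFinset m, r - 1 ≤ #{x ∈ A | G.Adj u x}}

/-- Copies of `K_r` meeting a fixed copy of `K_m`. -/
lemma choose_add_le_card_filter (h : FamSaturated m r G) (hr : 3 ≤ r)
    (hm : 2 * r ^ 2 + 2 * r ≤ m) (hne : (vertsOffCliques G m).Nonempty) {A : Finset V}
    (hA : G.IsNClique m A) :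
    m.choose r + max 1 #(fullyAttached G m r) ≤
      #{t ∈ G.cliqueFinset r | ∃ x ∈ t, x ∈ A} := by
  have hmr : 8 * r ≤ m := by nlinarith
  set R := vertsOffCliques G m with hR
  set M := {t ∈ G.cliqueFinset r | (∃ x ∈ t, x ∈ A) ∧ ∃ y ∈ t, y ∈ R} with hM
  have hdisj : Disjoint (powersetCard r A) M := by
    refine disjoint_left.2 fun t ht htM => ?_
    obtain ⟨-, -, y, hyt, hyR⟩ := mem_filter.1 htM
    exact mem_vertsOffCliques.1 hyR A hA ((mem_powersetCard.1 ht).1 hyt)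
  have hsub : powersetCard r A ∪ M ⊆ {t ∈ G.cliqueFinset r | ∃ x ∈ t, x ∈ A} := by
    refine union_subset (fun t ht => ?_) fun t ht => ?_
    · obtain ⟨htA, htc⟩ := mem_powersetCard.1 ht
      obtain ⟨x, hx⟩ : t.Nonempty := card_pos.1 (by omega)
      exact mem_filter.2 ⟨mem_cliqueFinset_iff.2 ⟨hA.isClique.subset (coe_subset.2 htA), htc⟩,
        x, hx, htA hx⟩
    · rw [hM, mem_filter] at ht
      exact mem_filter.2 ⟨ht.1, ht.2.1⟩
  refine le_trans ?_ (card_le_card hsub)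
  rw [card_union_of_disjoint hdisj, card_powersetCard, hA.card_eq]
  refine Nat.add_le_add_left (max_le ?_ ?_) _
  · rw [Nat.one_le_iff_ne_zero, ← Nat.pos_iff_ne_zero, card_pos]
    obtain ⟨u, hu⟩ := hne
    have hmix : ∀ S ⊆ A, #S = r - 1 → (∀ s ∈ S, G.Adj u s) → M.Nonempty := by
      intro S hSA hSc hSu
      obtain ⟨x, hx⟩ : S.Nonempty := card_pos.1 (by omega)
      exact ⟨insert u S, mem_filter.2 ⟨mem_cliqueFinset_iff.2
        (isNClique_insert_of_subset hA (by omega) hSA hSc hSu),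
        ⟨x, mem_insert_of_mem hx, hSA hx⟩, u, mem_insert_self _ _, hu⟩⟩
    obtain ⟨v, hvA, huv⟩ : ∃ v ∈ A, ¬ G.Adj u v := by
      by_contra! hall
      have := h.card_lt_of_adj hA (mem_vertsOffCliques.1 hu A hA) subset_rfl hall
      rw [hA.card_eq] at this
      omega
    rcases h.exists_subset_or_exists_clique (by omega) (by omega) hA hvA
      (mem_vertsOffCliques.1 hu) huv with ⟨S, hSA, hSc, hSu⟩ | ⟨Q, hQ, hQadj, hQR⟩
    · exact hmix S hSA hSc hSu
    · obtain ⟨S, hSQ, hSc⟩ := exists_subset_card_eq (show r - 1 ≤ #Q by rw [hQ.card_eq]; omega)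
      obtain ⟨x, hx⟩ : S.Nonempty := card_pos.1 (by omega)
      refine ⟨insert v S, mem_filter.2 ⟨mem_cliqueFinset_iff.2
        (isNClique_insert_of_subset hQ (by omega) hSQ hSc fun s hs => (hQadj s (hSQ hs)).2),
        ⟨v, mem_insert_self _ _, hvA⟩, x, mem_insert_of_mem hx, ?_⟩⟩
      exact mem_vertsOffCliques.2 (hQR x (hSQ hx))
  · rw [← mul_one #M, ← mul_one #(fullyAttached G m r)]
    refine card_mul_le_card_mul (fun u t => t ∩ R = {u}) (fun u hu => ?_) fun t _ => ?_
    · obtain ⟨huR, huA⟩ := mem_filter.1 hu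
      obtain ⟨S, hSsub, hSc⟩ := exists_subset_card_eq (huA A (mem_cliqueFinset_iff.2 hA))
      have hSA : S ⊆ A := hSsub.trans (filter_subset _ _)
      obtain ⟨x, hx⟩ : S.Nonempty := card_pos.1 (by omega)
      rw [Nat.one_le_iff_ne_zero, ← Nat.pos_iff_ne_zero, card_pos]
      refine ⟨insert u S, (mem_bipartiteAbove _).2 ⟨mem_filter.2 ⟨mem_cliqueFinset_iff.2
        (isNClique_insert_of_subset hA (by omega) hSA hSc fun s hs => (mem_filter.1 (hSsub hs)).2),
        ⟨x, mem_insert_of_mem hx, hSA hx⟩, u, mem_insert_self _ _, huR⟩, ?_⟩⟩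
      have hSR : S ∩ R = ∅ := by
        refine eq_empty_of_forall_notMem fun y hy => ?_
        obtain ⟨hyS, hyR⟩ := mem_inter.1 hy
        exact mem_vertsOffCliques.1 hyR A hA (hSA hyS)
      rw [insert_inter_of_mem huR, hSR, insert_empty_eq]
    · rw [card_le_one]
      intro p hp q hq
      rw [mem_bipartiteBelow] at hp hq
      exact singleton_injective (hp.2.symm.trans hq.2)

/-- The count of copies of `K_r` split by the copies of `K_m` they meet. -/
lemma card_cliqueFinset_lower_bound (h : FamSaturated m r G) (hr : 3 ≤ r)
    (hm : 2 * r ^ 2 + 2 * r ≤ m) (hne : (vertsOffCliques G m).Nonempty) :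
    ∃ s, #(G.cliqueFinset m) * (m.choose r + max 1 #(fullyAttached G m r)) + s
        ≤ #(G.cliqueFinset r) ∧
      (#(vertsOffCliques G m) - #(fullyAttached G m r)) * ((m - 1).choose (r - 1) + 1) ≤ s * r := by
  set R := vertsOffCliques G m with hR
  set S := {t ∈ G.cliqueFinset r | t ⊆ R} with hS
  refine ⟨#S, ?_, ?_⟩
  · set P := (G.cliqueFinset m).biUnion fun A => {t ∈ G.cliqueFinset r | ∃ x ∈ t, x ∈ A} with hP
    have hPc : #(G.cliqueFinset m) * (m.choose r + max 1 #(fullyAttached G m r)) ≤ #P := by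
      rw [hP, card_biUnion]
      · rw [← smul_eq_mul]
        exact card_nsmul_le_sum _ _ _ fun A hA =>
          h.choose_add_le_card_filter hr hm hne (mem_cliqueFinset_iff.1 hA)
      · intro A hA B hB hAB
        have hA' := mem_cliqueFinset_iff.1 hA
        have hB' := mem_cliqueFinset_iff.1 hB
        refine disjoint_left.2 fun t htA htB => ?_
        obtain ⟨ht, x, hxt, hxA⟩ := mem_filter.1 htA
        obtain ⟨-, y, hyt, hyB⟩ := mem_filter.1 htB
        have hxy : x ≠ y := fun e => disjoint_left.1 (h.disjoint_of_ne hA' hB' hAB) hxA (e ▸ hyB)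
        exact h.not_adj_of_ne hA' hB' hAB hxA hyB
          ((mem_cliqueFinset_iff.1 ht).isClique hxt hyt hxy)
    have hPS : Disjoint P S := by
      refine disjoint_left.2 fun t htP htS => ?_
      obtain ⟨A, hA, htA⟩ := mem_biUnion.1 htP
      obtain ⟨-, x, hxt, hxA⟩ := mem_filter.1 htA
      exact mem_vertsOffCliques.1 ((mem_filter.1 htS).2 hxt) A (mem_cliqueFinset_iff.1 hA) hxA
    refine (Nat.add_le_add_right hPc _).trans ?_
    rw [← card_union_of_disjoint hPS]
    exact card_le_card (union_subset (biUnion_subset.2 fun A _ => filter_subset _ _)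
      (filter_subset _ _))
  · rw [← card_sdiff_of_subset (show fullyAttached G m r ⊆ R from filter_subset _ _)]
    refine card_mul_le_of_forall_le_card_filter
      (fun t ht => (mem_cliqueFinset_iff.1 (mem_filter.1 ht).1).card_eq) fun u hu => ?_
    obtain ⟨huR, hu'⟩ := mem_sdiff.1 hu
    obtain ⟨A, hA, huA⟩ : ∃ A ∈ G.cliqueFinset m, #{x ∈ A | G.Adj u x} < r - 1 := by
      by_contra! hall
      exact hu' (mem_filter.2 ⟨huR, hall⟩)
    rw [hS, filter_filter]
    exact h.choose_lt_card_filter hr hm huR (mem_cliqueFinset_iff.1 hA) huA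

end FamSaturated

end SaturatedCounting

section Bounds

lemma ContainsCopy.exists_adj {α : Type*} {F : SimpleGraph α} {G : SimpleGraph V}
    (h : ContainsCopy F G) {a b : α} (hab : F.Adj a b) : ∃ x y, G.Adj x y := by
  obtain ⟨f, -, hf⟩ := h
  exact ⟨_, _, hf _ _ hab⟩

lemma exists_famSaturated [Finite V] {m r : ℕ} (hm : 2 ≤ m) :
    ∃ G : SimpleGraph V, FamSaturated m r G := by
  have hbot : ∀ {N : ℕ} (F : SimpleGraph (Fin N)) {a b : Fin N}, F.Adj a b →
      ¬ ContainsCopy F (⊥ : SimpleGraph V) := by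
    intro N F a b hab h
    obtain ⟨x, y, hxy⟩ := h.exists_adj hab
    exact hxy
  obtain ⟨G, hG⟩ := (Set.toFinite {G : SimpleGraph V | ¬ ContainsCopy (dumbbell m) G ∧
    ¬ ContainsCopy (VgraphGen m r) G ∧ ¬ ContainsCopy (lambdaGraphGen m r) G}).exists_maximal
    ⟨⊥, hbot _ (a := ⟨0, by omega⟩) (b := ⟨1, by omega⟩) (by simp [dumbbell]; omega),
      hbot _ (a := ⟨0, by omega⟩) (b := ⟨1, by omega⟩) (by simp [VgraphGen]; omega),
      hbot _ (a := ⟨0, by omega⟩) (b := ⟨1, by omega⟩) (by simp [lambdaGraphGen]; omega)⟩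
  refine ⟨G, hG.prop.1, hG.prop.2.1, hG.prop.2.2, fun u v huv hadj => ?_⟩
  by_contra! hcon
  exact hadj (hG.le_of_ge hcon (le_addEdge G u v) (addEdge_adj.2 (Or.inr ⟨Or.inl ⟨rfl, rfl⟩, huv⟩)))

lemma cliqueCount_eq_card_cliqueFinset [Fintype V] [DecidableEq V] (G : SimpleGraph V)
    [DecidableRel G.Adj] (r : ℕ) : cliqueCount G r = #(G.cliqueFinset r) := by
  rw [← Set.ncard_coe_finset, coe_cliqueFinset]
  rfl

/-- The disjoint union of cliques on the fibres of `φ`. -/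
def fiberCliques {ι : Type*} (φ : V → ι) : SimpleGraph V where
  Adj x y := x ≠ y ∧ φ x = φ y
  symm := ⟨fun _ _ h => ⟨h.1.symm, h.2.symm⟩⟩
  loopless := ⟨fun _ h => h.1 rfl⟩

lemma fiberCliques_eq_of_isClique {ι : Type*} {φ : V → ι} {A : Set V}
    (hA : (fiberCliques φ).IsClique A) {x y : V}
    (hx : x ∈ A) (hy : y ∈ A) : φ x = φ y := by
  by_cases hxy : x = y
  · rw [hxy]
  · exact (hA hx hy hxy).2

section FiberCliques

variable [Fintype V] [DecidableEq V] {ι : Type*} [DecidableEq ι] {φ : V → ι} {m : ℕ}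

lemma famSaturated_fiberCliques {r : ℕ} (hr : 1 ≤ r) (hrm : r < m)
    (hφ : ∀ q, #{x | φ x = q} = m) : FamSaturated m r (fiberCliques φ) := by
  have hle : ∀ (T : Finset V) (q : ι), (∀ x ∈ T, φ x = q) → #T ≤ m := fun T q hT =>
    hφ q ▸ card_le_card fun x hx => mem_filter.2 ⟨mem_univ x, hT x hx⟩
  refine ⟨fun hc => ?_, fun hc => ?_, fun hc => ?_, fun u v huv hadj => Or.inl ?_⟩
  · obtain ⟨A, B, hA, hB, hAB, a, ha, b, hb, hab⟩ := exists_of_containsCopy_dumbbell (by omega) hc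
    have := hle (A ∪ B) (φ a) fun x hx => by
      rcases mem_union.1 hx with h | h
      · exact fiberCliques_eq_of_isClique hA.isClique h ha
      · exact (fiberCliques_eq_of_isClique hB.isClique h hb).trans hab.2.symm
    rw [card_union_of_disjoint hAB, hA.card_eq, hB.card_eq] at this
    omega
  · obtain ⟨A, B, y, hA, hB, hAB⟩ := exists_of_containsCopy_VgraphGen (by omega) hc
    have hy : y ∈ A ∩ B := by simp [hAB]
    rw [mem_inter] at hy
    have := hle (A ∪ B) (φ y) fun x hx => by
      rcases mem_union.1 hx with h | h
      · exact fiberCliques_eq_of_isClique hA.isClique h hy.1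
      · exact fiberCliques_eq_of_isClique hB.isClique h hy.2
    have h₂ := card_union_add_card_inter A B
    rw [hAB, hA.card_eq, hB.card_eq, card_singleton] at h₂
    omega
  · obtain ⟨A, S, p, hA, hp, hSA, hS, hpS⟩ := exists_of_containsCopy_lambdaGraphGen hrm.le hc
    obtain ⟨s, hs⟩ : S.Nonempty := card_pos.1 (by omega)
    have := hle (insert p A) (φ s) fun x hx => by
      rcases mem_insert.1 hx with rfl | h
      · exact (hpS s hs).2
      · exact fiberCliques_eq_of_isClique hA.isClique h (hSA hs)
    rw [card_insert_of_notMem hp, hA.card_eq] at this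
    omega
  · have huv' : φ u ≠ φ v := fun e => hadj ⟨huv, e⟩
    have hcl : ∀ q, (addEdge (fiberCliques φ) u v).IsNClique m ({x | φ x = q} : Finset V) := by
      refine fun q => ⟨fun x hx y hy hxy => le_addEdge _ _ _ ⟨hxy, ?_⟩, hφ q⟩
      simp only [coe_filter, mem_univ, true_and, Set.mem_ofPred_eq] at hx hy
      rw [hx, hy]
    refine containsCopy_dumbbell (hcl (φ u)) (hcl (φ v)) ?_ (a := u) (b := v) (by simp) (by simp)
      (addEdge_adj.2 (Or.inr ⟨Or.inl ⟨rfl, rfl⟩, huv⟩))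
    refine disjoint_left.2 fun x hx hx' => huv' ?_
    rw [← (mem_filter.1 hx).2, (mem_filter.1 hx').2]

lemma cliqueCount_fiberCliques_le [Fintype ι] {r : ℕ} (hr : 1 ≤ r)
    (hφ : ∀ q, #{x | φ x = q} = m) :
    cliqueCount (fiberCliques φ) r ≤ Fintype.card ι * m.choose r := by
  have hsub : {t : Finset V | (fiberCliques φ).IsNClique r t} ⊆
      ((univ : Finset ι).biUnion fun q => powersetCard r ({x | φ x = q} : Finset V) :
        Finset (Finset V)) := by
    intro t ht
    have ht' : (fiberCliques φ).IsNClique r t := ht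
    obtain ⟨y, hy⟩ : t.Nonempty := card_pos.1 (by rw [ht'.card_eq]; omega)
    simp only [coe_biUnion, Set.mem_iUnion, mem_coe, mem_powersetCard]
    refine ⟨φ y, mem_univ _, fun x hx => ?_, ht'.card_eq⟩
    exact mem_filter.2 ⟨mem_univ x, fiberCliques_eq_of_isClique ht'.isClique hx hy⟩
  refine (Set.ncard_le_ncard hsub (finite_toSet _)).trans ?_
  rw [Set.ncard_coe_finset]
  refine card_biUnion_le_card_mul _ _ _ fun q _ => ?_
  rw [card_powersetCard, hφ q]

end FiberCliques

lemma satCliquesFam3_le_of_dvd {r m n : ℕ} (hr : 1 ≤ r) (hrm : r < m) (hn : m ∣ n) :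
    satCliquesFam3 n r (dumbbell m) (VgraphGen m r) (lambdaGraphGen m r)
      ≤ n / m * m.choose r := by
  obtain ⟨k, rfl⟩ := hn
  rw [Nat.mul_div_cancel_left _ (by omega)]
  have e : Fin (m * k) ≃ Fin k × Fin m := (finCongr (mul_comm m k)).trans finProdFinEquiv.symm
  set φ : Fin (m * k) → Fin k := fun x => (e x).1 with hφ
  have hcard : ∀ q, #{x | φ x = q} = m := by
    intro q
    have : ({x | φ x = q} : Finset (Fin (m * k))) = univ.image fun j => e.symm (q, j) := by
      ext x
      simp only [hφ, mem_filter, mem_univ, true_and, mem_image, Equiv.symm_apply_eq]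
      constructor
      · rintro rfl
        exact ⟨(e x).2, rfl⟩
      · rintro ⟨j, hj⟩
        rw [← hj]
    rw [this, card_image_of_injective, card_univ, Fintype.card_fin]
    intro i j hij
    simpa using hij
  have := cliqueCount_fiberCliques_le hr hcard
  rw [Fintype.card_fin] at this
  have hsat : FamSaturated m r (fiberCliques φ) := famSaturated_fiberCliques hr hrm hcard
  have hle : satCliquesFam3 (m * k) r (dumbbell m) (VgraphGen m r) (lambdaGraphGen m r)
      ≤ cliqueCount (fiberCliques φ) r := Nat.sInf_le ⟨_, hsat, rfl⟩
  exact hle.trans this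

namespace FamSaturated

variable [Fintype V] [DecidableEq V] {G : SimpleGraph V} [DecidableRel G.Adj] {m r : ℕ}

lemma card_mul_le_of_many_cliques (h : FamSaturated m r G) (hr : 3 ≤ r)
    (hm : 2 * r ^ 2 + 2 * r ≤ m) (hne : (vertsOffCliques G m).Nonempty)
    (hk : m.choose r + 1 ≤ #(G.cliqueFinset m)) :
    Fintype.card V * (m.choose r + 1) ≤ m * (#(G.cliqueFinset r) + (m.choose r + 1)) := by
  obtain ⟨s, hs, hs'⟩ := h.card_cliqueFinset_lower_bound hr hm hne
  have ha : #(fullyAttached G m r) ≤ #(vertsOffCliques G m) := card_le_card (filter_subset _ _)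
  obtain ⟨b, hb⟩ := Nat.exists_eq_add_of_le ha
  have hE : m * (m - 1).choose (r - 1) = m.choose r * r := by
    have := Nat.add_one_mul_choose_eq (m - 1) (r - 1)
    rwa [Nat.sub_add_cancel (by nlinarith), Nat.sub_add_cancel (by omega)] at this
  rw [← h.card_vertsOffCliques, hb]
  rw [hb, Nat.add_sub_cancel_left] at hs'
  set a := #(fullyAttached G m r)
  set k := #(G.cliqueFinset m)
  set E := (m - 1).choose (r - 1)
  set C := m.choose r
  have hrm : r ≤ m := by nlinarith
  have hms : b * (C + 1) ≤ m * s := by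
    refine Nat.le_of_mul_le_mul_right (c := r) ?_ (by omega)
    calc b * (C + 1) * r = b * (C * r + r) := by ring
      _ ≤ b * (m * E + m) := Nat.mul_le_mul_left _ (by omega)
      _ = m * (b * (E + 1)) := by ring
      _ ≤ m * s * r := by rw [mul_assoc]; exact Nat.mul_le_mul_left _ hs'
  have hka : m * k + a * (C + 1) ≤ m * (k * max 1 a) + m * (C + 1) := by
    have hC : C + 1 ≤ m * (C + 1) := Nat.le_mul_of_pos_left _ (by omega)
    have hmk : C + 1 ≤ m * k := hk.trans (Nat.le_mul_of_pos_left _ (by omega))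
    rcases a with _ | a
    · simp
    · rw [max_eq_right (by omega)]
      have := Nat.mul_le_mul_left a hmk
      linarith
  calc (k * m + (a + b)) * (C + 1)
      = m * (k * C) + (m * k + a * (C + 1)) + b * (C + 1) := by ring
    _ ≤ m * (k * C) + (m * (k * max 1 a) + m * (C + 1)) + m * s := by gcongr
    _ = m * (k * (C + max 1 a) + s + (C + 1)) := by ring
    _ ≤ _ := by gcongr

lemma card_mul_le_of_few_cliques (h : FamSaturated m r G) (hr : 3 ≤ r)
    (hm : 2 * r ^ 2 + 2 * r ≤ m) (hk : #(G.cliqueFinset m) ≤ m.choose r) {T c : ℕ}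
    (hT : T = 6 * r * (m.choose r + 1)) (hc : c = T + r + r * (T * r)) :
    Fintype.card V * (m.choose r + 1) ≤
      m * (#(G.cliqueFinset r) +
        (c * (m - r - 1).choose (r - 1) + m.choose r * r * m.choose r)) := by
  have hmr : 8 * r ≤ m := by nlinarith
  set R := vertsOffCliques G m with hR
  set L := {u ∈ R | #{t ∈ G.cliqueFinset r | u ∈ t} ≤ T} with hL
  set H := {u ∈ R | ¬ #{t ∈ G.cliqueFinset r | u ∈ t} ≤ T} with hH
  have hLH : #L + #H = #R := card_filter_add_card_filter_not _
  have hHN : #H * (T + 1) ≤ #(G.cliqueFinset r) * r := by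
    refine card_mul_le_of_forall_le_card_filter
      (fun t ht => (mem_cliqueFinset_iff.1 ht).card_eq) fun u hu => ?_
    have := (mem_filter.1 hu).2
    omega
  have hLN := card_sub_mul_choose_le (r := r) (s := m - r - 1) (T := T) (by omega) (by omega) L
    (fun u hu v hv huv hadj => h.exists_common_clique (by omega) (by omega) huv hadj
      (mem_vertsOffCliques.1 (mem_filter.1 hu).1) (mem_vertsOffCliques.1 (mem_filter.1 hv).1))
    fun u hu => (mem_filter.1 hu).2
  rw [← hc] at hLN
  have hn := h.card_vertsOffCliques
  rw [← hR] at hn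
  have hE : m * (m - 1).choose (r - 1) = m.choose r * r := by
    have := Nat.add_one_mul_choose_eq (m - 1) (r - 1)
    rwa [Nat.sub_add_cancel (by omega), Nat.sub_add_cancel (by omega)] at this
  have hED := choose_le_two_mul_choose (by omega) hm
  have hE₀ : 0 < (m - 1).choose (r - 1) := Nat.choose_pos (by omega)
  set k := #(G.cliqueFinset m)
  set N := #(G.cliqueFinset r)
  set D := (m - r - 1).choose (r - 1)
  set E := (m - 1).choose (r - 1)
  set C := m.choose r
  set n := Fintype.card V
  have hC : 8 ≤ C := by
    refine Nat.le_of_mul_le_mul_right (c := r) ?_ (by omega)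
    nlinarith
  by_cases hcase : n ≤ 6 * #H
  · have h₁ : 6 * #H * (C + 1) ≤ N := by
      refine Nat.le_of_mul_le_mul_right (c := r) ?_ (by omega)
      calc 6 * #H * (C + 1) * r = #H * T := by rw [hT]; ring
        _ ≤ #H * (T + 1) := Nat.mul_le_mul_left _ (by omega)
        _ ≤ N * r := hHN
    calc n * (C + 1) ≤ 6 * #H * (C + 1) := Nat.mul_le_mul_right _ hcase
      _ ≤ N := h₁
      _ ≤ m * N := Nat.le_mul_of_pos_left _ (by omega)
      _ ≤ _ := by gcongr; omega
  · have hLD : #L * D ≤ N + c * D := by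
      rw [Nat.sub_mul] at hLN
      omega
    have hL5 : 5 * n ≤ 6 * #L + 6 * (C * m) := by
      have := Nat.mul_le_mul_right m hk
      omega
    have h₁ : 6 * #L * (C * r) ≤ 12 * (m * (N + c * D)) := calc
      6 * #L * (C * r) = 6 * #L * m * E := by rw [← hE]; ring
      _ ≤ 6 * #L * m * (2 * D) := Nat.mul_le_mul_left _ hED
      _ = 12 * (m * (#L * D)) := by ring
      _ ≤ _ := by gcongr
    have h₂ : 12 * (C + 1) ≤ 5 * (C * r) := by nlinarith
    have h₃ : 12 * (n * (C + 1)) ≤ 12 * (m * (N + (c * D + C * r * C))) := calc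
      12 * (n * (C + 1)) = n * (12 * (C + 1)) := by ring
      _ ≤ n * (5 * (C * r)) := Nat.mul_le_mul_left _ h₂
      _ = 5 * n * (C * r) := by ring
      _ ≤ (6 * #L + 6 * (C * m)) * (C * r) := Nat.mul_le_mul_right _ hL5
      _ = 6 * #L * (C * r) + 6 * (m * (C * r * C)) := by ring
      _ ≤ 12 * (m * (N + c * D)) + 12 * (m * (C * r * C)) := by gcongr; omega
      _ = _ := by ring
    omega

end FamSaturated

lemma exists_cliqueCount_lower_bound {r m : ℕ} (hr : 3 ≤ r) (hm : 2 * r ^ 2 + 2 * r ≤ m) :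
    ∃ K : ℕ, ∀ n, ¬ m ∣ n → ∀ G : SimpleGraph (Fin n), FamSaturated m r G →
      n * (m.choose r + 1) ≤ m * (cliqueCount G r + K) := by
  classical
  set T := 6 * r * (m.choose r + 1) with hT
  set c := T + r + r * (T * r) with hc
  refine ⟨(m.choose r + 1) +
    (c * (m - r - 1).choose (r - 1) + m.choose r * r * m.choose r), fun n hn G h => ?_⟩
  rw [cliqueCount_eq_card_cliqueFinset]
  have hne : (vertsOffCliques G m).Nonempty := by
    rw [nonempty_iff_ne_empty]
    intro h₀
    refine hn ⟨#(G.cliqueFinset m), ?_⟩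
    have := h.card_vertsOffCliques
    rw [h₀, card_empty, Fintype.card_fin] at this
    linarith
  rcases le_or_gt (m.choose r + 1) #(G.cliqueFinset m) with hk | hk
  · have := h.card_mul_le_of_many_cliques hr hm hne hk
    rw [Fintype.card_fin] at this
    refine this.trans (Nat.mul_le_mul_left _ ?_)
    omega
  · have := h.card_mul_le_of_few_cliques hr hm (by omega) hT hc
    rw [Fintype.card_fin] at this
    refine this.trans (Nat.mul_le_mul_left _ ?_)
    omega

end Bounds

/-- Let `r ≥ 3`, `m ≥ 2r² + 2r` and `ℱ_m = {B_{m,m}, V_{m,r}, Λ_{m,r}}`.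
Then (i) for every `n` divisible by `m`, `sat(n, K_r, ℱ_m) ≤ (n/m)·C(m,r)`; and (ii) for every
`ε > 0` there is `n₀` such that for all `n ≥ n₀` not divisible by `m`,
`sat(n, K_r, ℱ_m) ≥ (n/m)·(C(m,r) + 1) - ε·n`. -/
theorem satCliquesFam3_bounds (r m : ℕ) (hr : 3 ≤ r) (hm : 2 * r ^ 2 + 2 * r ≤ m) :
    (∀ n : ℕ, m ∣ n →
      satCliquesFam3 n r (dumbbell m) (VgraphGen m r) (lambdaGraphGen m r)
        ≤ n / m * m.choose r) ∧
    (∀ ε : ℝ, 0 < ε → ∃ n₀ : ℕ, ∀ n ≥ n₀, ¬ m ∣ n →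
      (n : ℝ) / (m : ℝ) * ((m.choose r : ℝ) + 1) - ε * (n : ℝ) ≤
        (satCliquesFam3 n r (dumbbell m) (VgraphGen m r) (lambdaGraphGen m r) : ℝ)) := by
  have hrm : r < m := by nlinarith
  refine ⟨fun n hn => satCliquesFam3_le_of_dvd (by omega) hrm hn, fun ε hε => ?_⟩
  obtain ⟨K, hK⟩ := exists_cliqueCount_lower_bound hr hm
  obtain ⟨n₀, hn₀⟩ := exists_nat_ge ((K : ℝ) / ε)
  refine ⟨n₀, fun n hn hmn => ?_⟩
  obtain ⟨G₀, hG₀⟩ := exists_famSaturated (V := Fin n) (m := m) (r := r) (by omega)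
  obtain ⟨G, hG, hGs⟩ := Nat.sInf_mem (s := {c | ∃ G : SimpleGraph (Fin n),
    FamSaturated m r G ∧ cliqueCount G r = c}) ⟨_, G₀, hG₀, rfl⟩
  have hsat : satCliquesFam3 n r (dumbbell m) (VgraphGen m r) (lambdaGraphGen m r)
      = cliqueCount G r := hGs.symm
  have hm₀ : (0 : ℝ) < m := by exact_mod_cast (by omega : 0 < m)
  have hb : (n : ℝ) * ((m.choose r : ℝ) + 1) ≤ m * ((cliqueCount G r : ℝ) + K) := by
    exact_mod_cast hK n hmn G hG
  have hKn : (K : ℝ) ≤ ε * n := by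
    rw [div_le_iff₀ hε] at hn₀
    have : (n₀ : ℝ) ≤ n := by exact_mod_cast hn
    nlinarith
  have hX : (n : ℝ) / m * ((m.choose r : ℝ) + 1) ≤ (cliqueCount G r : ℝ) + K := by
    rw [div_mul_eq_mul_div, div_le_iff₀ hm₀]
    linarith
  rw [hsat]
  linarith
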